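/- Let V be a real vector space of finite dimension 2n with n ≥ 1, and let ω be an element of the second exterior power ⋀²V, viewed inside the exterior algebra ⋀V, such that the n-fold product ω ∧ ⋯ ∧ ω (n factors) is nonzero in ⋀^{2n}V. Then for every k with n + 1 ≤ k ≤ 2n, the linear map from ⋀^k V to ⋀^{k+2} V given by x ↦ ω ∧ x is surjective (where ⋀^{k+2} V = 0 when k + 2 > 2n). -/

import Mathlib

open CliffordAlgebra in
/-- Contraction with a covector is a derivation with respect to multiplication by a bivector. -/
theorem ExteriorAlgebra.contractLeft_bivector_mul {V : Type*} [AddCommGroup V] [Module ℝ V]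
    (α : Module.Dual ℝ V) {ω : ExteriorAlgebra ℝ V} (hω : ω ∈ ⋀[ℝ]^2 V)
    (x : ExteriorAlgebra ℝ V) :
    contractLeft α (ω * x) = contractLeft α ω * x + ω * contractLeft α x := by
  rw [exteriorPower, pow_two] at hω
  induction hω using Submodule.mul_induction_on' with
  | mem_mul_mem a ha b hb =>
    obtain ⟨a, rfl⟩ := ha
    obtain ⟨b, rfl⟩ := hb
    simp only [ExteriorAlgebra.ι, mul_assoc, contractLeft_ι_mul, contractLeft_ι, sub_mul,
      mul_sub, smul_mul_assoc, mul_smul_comm, Algebra.commutes]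
    simp only [Algebra.algebraMap_eq_smul_one, mul_smul_comm, mul_one]
    abel
  | add a _ b _ iha ihb => simp only [add_mul, map_add, iha, ihb]; abel

open CliffordAlgebra in
theorem ExteriorAlgebra.contractLeft_bivector_mem {V : Type*} [AddCommGroup V] [Module ℝ V]
    (α : Module.Dual ℝ V) {ω : ExteriorAlgebra ℝ V} (hω : ω ∈ ⋀[ℝ]^2 V) :
    contractLeft α ω ∈ LinearMap.range (ExteriorAlgebra.ι ℝ (M := V)) := by
  rw [exteriorPower, pow_two] at hω
  induction hω using Submodule.mul_induction_on' with
  | mem_mul_mem a ha b hb =>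
    obtain ⟨a, rfl⟩ := ha
    obtain ⟨b, rfl⟩ := hb
    refine ⟨α a • b - α b • a, ?_⟩
    simp [ExteriorAlgebra.ι, contractLeft_ι_mul, contractLeft_ι, Algebra.algebraMap_eq_smul_one]
  | add a _ b _ iha ihb => rw [map_add]; exact add_mem iha ihb

theorem ExteriorAlgebra.bivector_commute_ι {V : Type*} [AddCommGroup V] [Module ℝ V]
    {ω : ExteriorAlgebra ℝ V} (hω : ω ∈ ⋀[ℝ]^2 V) (v : V) :
    Commute ω (ExteriorAlgebra.ι ℝ v) := by
  have anti (a b : V) : ι ℝ a * ι ℝ b = -(ι ℝ b * ι ℝ a) :=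
    eq_neg_of_add_eq_zero_left (ExteriorAlgebra.ι_add_mul_swap a b)
  rw [exteriorPower, pow_two] at hω
  induction hω using Submodule.mul_induction_on' with
  | mem_mul_mem a ha b hb =>
    obtain ⟨a, rfl⟩ := ha
    obtain ⟨b, rfl⟩ := hb
    rw [commute_iff_eq, mul_assoc, anti b v, mul_neg, ← mul_assoc, anti a v, neg_mul, neg_neg,
      mul_assoc]
  | add a _ b _ iha ihb => exact iha.add_left ihb

open CliffordAlgebra in
theorem ExteriorAlgebra.contractLeft_bivector_pow_mul {V : Type*} [AddCommGroup V] [Module ℝ V]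
    (α : Module.Dual ℝ V) {ω : ExteriorAlgebra ℝ V} (hω : ω ∈ ⋀[ℝ]^2 V) (s : ℕ)
    (x : ExteriorAlgebra ℝ V) :
    contractLeft α (ω ^ (s + 1) * x) =
      (s + 1 : ℝ) • (ω ^ s * (contractLeft α ω * x)) + ω ^ (s + 1) * contractLeft α x := by
  obtain ⟨v, hv⟩ := contractLeft_bivector_mem α hω
  have hc : Commute ω (contractLeft α ω) := hv ▸ bivector_commute_ι hω v
  induction s with
  | zero => simp [contractLeft_bivector_mul α hω]
  | succ s ih =>
    rw [pow_succ' ω (s + 1), mul_assoc, contractLeft_bivector_mul α hω, ih, mul_add,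
      mul_smul_comm, ← mul_assoc ω (ω ^ s), ← pow_succ', ← mul_assoc _ (ω ^ (s + 1)),
      ← (hc.pow_left (s + 1)).eq, mul_assoc (ω ^ (s + 1)), Nat.cast_succ, mul_assoc ω]
    module

theorem exteriorPower.eq_zero_of_finrank_lt {V : Type*} [AddCommGroup V] [Module ℝ V]
    [FiniteDimensional ℝ V] {m : ℕ} (hm : Module.finrank ℝ V < m) {x : ExteriorAlgebra ℝ V}
    (hx : x ∈ ⋀[ℝ]^m V) : x = 0 := by
  have h : Module.finrank ℝ (⋀[ℝ]^m V) = 0 := by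
    rw [exteriorPower.finrank_eq, Nat.choose_eq_zero_of_lt hm]
  rw [Submodule.finrank_eq_zero] at h
  rwa [h, Submodule.mem_bot] at hx

theorem ExteriorAlgebra.bivector_pow_mem {V : Type*} [AddCommGroup V] [Module ℝ V]
    {ω : ExteriorAlgebra ℝ V} (hω : ω ∈ ⋀[ℝ]^2 V) (m : ℕ) : ω ^ m ∈ ⋀[ℝ]^(2 * m) V := by
  rw [exteriorPower, pow_mul]
  exact Submodule.pow_mem_pow _ hω m

open CliffordAlgebra in
/-- A bivector with nonzero top power is nondegenerate: every vector is a contraction of it. -/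
theorem ExteriorAlgebra.exists_contractLeft_eq_ι {V : Type*} [AddCommGroup V] [Module ℝ V]
    [FiniteDimensional ℝ V] {n : ℕ} (hn : 1 ≤ n) (hdim : Module.finrank ℝ V = 2 * n)
    {ω : ExteriorAlgebra ℝ V} (hω : ω ∈ ⋀[ℝ]^2 V) (hnd : ω ^ n ≠ 0) (v : V) :
    ∃ α : Module.Dual ℝ V, contractLeft α ω = ExteriorAlgebra.ι ℝ v := by
  let f : Module.Dual ℝ V →ₗ[ℝ] V :=
    ExteriorAlgebra.ιInv ∘ₗ (contractLeft (Q := (0 : QuadraticForm ℝ V))).flip ω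
  have hf (α : Module.Dual ℝ V) : ExteriorAlgebra.ι ℝ (f α) = contractLeft α ω := by
    obtain ⟨w, hw⟩ := contractLeft_bivector_mem α hω
    have : f α = w := by
      change ExteriorAlgebra.ιInv (contractLeft α ω) = w
      rw [← hw]
      exact ExteriorAlgebra.ι_leftInverse w
    rw [this, hw]
  have hinj : Function.Injective f := by
    rw [injective_iff_map_eq_zero]
    intro α hα
    by_contra hne
    obtain ⟨w, hw⟩ : ∃ w, α w ≠ 0 := by
      by_contra! h
      exact hne (LinearMap.ext h)
    have hαω : contractLeft α ω = 0 := by rw [← hf, hα, map_zero]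
    obtain ⟨m, rfl⟩ : ∃ m, n = m + 1 := ⟨n - 1, by omega⟩
    have hpow : contractLeft α (ω ^ (m + 1)) = 0 := by
      have := contractLeft_bivector_pow_mul α hω m 1
      simpa [hαω] using this
    have htop : ExteriorAlgebra.ι ℝ w * ω ^ (m + 1) = 0 := by
      refine exteriorPower.eq_zero_of_finrank_lt (m := 2 * (m + 1) + 1) (by omega) ?_
      rw [exteriorPower, pow_succ']
      exact Submodule.mul_mem_mul ⟨w, rfl⟩ (bivector_pow_mem hω _)
    have h := contractLeft_ι_mul (Q := (0 : QuadraticForm ℝ V)) (d := α) w (ω ^ (m + 1))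
    change contractLeft α (ExteriorAlgebra.ι ℝ w * ω ^ (m + 1)) = _ at h
    rw [htop, hpow, map_zero, mul_zero, sub_zero] at h
    exact (smul_ne_zero hw hnd) h.symm
  obtain ⟨α, hα⟩ := (LinearMap.injective_iff_surjective_of_finrank_eq_finrank
    Subspace.dual_finrank_eq).mp hinj v
  exact ⟨α, by rw [← hf, hα]⟩

open CliffordAlgebra in
/-- Descent step: contracting a divisibility relation lowers the power of `ω` by one. -/
theorem ExteriorAlgebra.exists_bivector_pow_mul_ι_mul {V : Type*} [AddCommGroup V] [Module ℝ V]
    {ω : ExteriorAlgebra ℝ V} (hω : ω ∈ ⋀[ℝ]^2 V) {v : V}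
    (hv : ∃ α : Module.Dual ℝ V, contractLeft α ω = ExteriorAlgebra.ι ℝ v) {s : ℕ}
    {x y : ExteriorAlgebra ℝ V} (h : ω ^ (s + 1) * x = ω ^ (s + 2) * y) :
    ∃ z, ω ^ s * (ExteriorAlgebra.ι ℝ v * x) = ω ^ (s + 1) * z := by
  obtain ⟨α, hα⟩ := hv
  have h' := congrArg (contractLeft α) h
  rw [contractLeft_bivector_pow_mul α hω, contractLeft_bivector_pow_mul α hω, hα] at h'
  refine ⟨(s + 1 : ℝ)⁻¹ • (((s + 1 : ℕ) + 1 : ℝ) • (ExteriorAlgebra.ι ℝ v * y)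
    + ω * contractLeft α y - contractLeft α x), ?_⟩
  have hs : (s + 1 : ℝ) ≠ 0 := by positivity
  rw [mul_smul_comm, eq_inv_smul_iff₀ hs, eq_sub_of_add_eq h', mul_sub, mul_add, mul_smul_comm,
    ← mul_assoc _ ω, ← pow_succ]

/-- Every element of degree `j` becomes divisible by one more power of `ω` after multiplication
by `ω ^ (n + 1 - j)`. -/
theorem ExteriorAlgebra.exists_bivector_pow_mul_eq {V : Type*} [AddCommGroup V] [Module ℝ V]
    [FiniteDimensional ℝ V] {n : ℕ} (hn : 1 ≤ n) (hdim : Module.finrank ℝ V = 2 * n)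
    {ω : ExteriorAlgebra ℝ V} (hω : ω ∈ ⋀[ℝ]^2 V) (hnd : ω ^ n ≠ 0) {j : ℕ}
    {x : ExteriorAlgebra ℝ V} (hx : x ∈ ⋀[ℝ]^j V) :
    ∃ y, ω ^ (n + 1 - j) * x = ω ^ (n + 1 - j + 1) * y := by
  rw [exteriorPower] at hx
  induction hx using Submodule.pow_induction_on_left' with
  | algebraMap r =>
    refine ⟨0, ?_⟩
    have h : ω ^ (n + 1) = 0 :=
      exteriorPower.eq_zero_of_finrank_lt (by omega) (bivector_pow_mem hω (n + 1))
    simp [h]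
  | add x y i _ _ ihx ihy =>
    obtain ⟨a, ha⟩ := ihx
    obtain ⟨b, hb⟩ := ihy
    exact ⟨a + b, by rw [mul_add, mul_add, ha, hb]⟩
  | mem_mul m hm i x _ ih =>
    obtain ⟨v, rfl⟩ := hm
    obtain ⟨y, hy⟩ := ih
    rcases le_or_gt (n + 1) i with hi | hi
    · rw [Nat.sub_eq_zero_of_le hi, zero_add, pow_zero, pow_one, one_mul] at hy
      rw [Nat.sub_eq_zero_of_le (by omega), zero_add, pow_zero, pow_one, one_mul]
      exact ⟨ι ℝ v * y, by
        rw [hy, ← mul_assoc, ← mul_assoc, (bivector_commute_ι hω v).eq]⟩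
    · obtain ⟨s, hs⟩ : ∃ s, n + 1 - i = s + 1 := ⟨n - i, by omega⟩
      rw [hs] at hy
      rw [show n + 1 - (i + 1) = s by omega]
      exact exists_bivector_pow_mul_ι_mul hω (exists_contractLeft_eq_ι hn hdim hω hnd v) hy


/-- Lefschetz-type surjectivity: if `V` is a real vector space of dimension `2n` and
`ω ∈ ⋀²V` satisfies `ω^n ≠ 0` (nondegeneracy), then for `n + 1 ≤ k ≤ 2n` the exterior
multiplication `⋀^k V → ⋀^{k+2} V`, `x ↦ ω ∧ x`, is surjective (where `⋀^{k+2} V = 0`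
when `k + 2 > 2n`). -/
theorem stmt9 (n : ℕ) (hn : 1 ≤ n) (V : Type*) [AddCommGroup V] [Module ℝ V]
    [FiniteDimensional ℝ V] (hdim : Module.finrank ℝ V = 2 * n)
    (ω : ExteriorAlgebra ℝ V) (hω : ω ∈ ⋀[ℝ]^2 V) (hnd : ω ^ n ≠ 0) :
    ∀ k : ℕ, n + 1 ≤ k → k ≤ 2 * n →
      Set.SurjOn (fun x => ω * x)
        ((⋀[ℝ]^k V : Submodule ℝ (ExteriorAlgebra ℝ V)) : Set (ExteriorAlgebra ℝ V))
        ((⋀[ℝ]^(k + 2) V : Submodule ℝ (ExteriorAlgebra ℝ V)) :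
          Set (ExteriorAlgebra ℝ V)) := by
  intro k hk _ x hx
  obtain ⟨y, hy⟩ := ExteriorAlgebra.exists_bivector_pow_mul_eq hn hdim hω hnd hx
  rw [Nat.sub_eq_zero_of_le (by omega), zero_add, pow_zero, pow_one, one_mul] at hy
  refine ⟨DirectSum.decompose (fun i : ℕ => ⋀[ℝ]^i V) y k, SetLike.coe_mem _, ?_⟩
  change ω * _ = x
  rw [← DirectSum.coe_decompose_mul_add_of_left_mem (fun i : ℕ => ⋀[ℝ]^i V) hω, ← hy,
    add_comm 2 k, DirectSum.decompose_of_mem_same (fun i : ℕ => ⋀[ℝ]^i V) hx]
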